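/- arXiv:1411.0471 — 7 statements merged into one kernel-verified Lean document; each statement's English description precedes it below -/
import Mathlib

section
/- For every ε > 0 there exists a C^∞ function M_ε : ℝ² → ℝ with the following properties: (1) M_ε is convex on ℝ²; (2) max{x, y} ≤ M_ε(x, y) ≤ max{x, y} + ε/2 for all (x, y) ∈ ℝ²; (3) M_ε(x, y) = max{x, y} whenever |x − y| ≥ ε; (4) M_ε(x, y) = M_ε(y, x) for all (x, y); (5) M_ε is 1-Lipschitz with respect to the supremum norm ‖(x, y)‖_∞ = max{|x|, |y|} on ℝ²; (6) if y − ε ≤ x < x′ then M_ε(x, y) < M_ε(x′, y); (7) if x − ε ≤ y < y′ then M_ε(x, y) < M_ε(x, y′); (8) if x ≤ x′ and y ≤ y′ then M_ε(x, y) ≤ M_ε(x′, y′), with strict inequality when both x < x′ and y < y′. -/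
theorem smoothTransition_add_one_sub (a : ℝ) :
    Real.smoothTransition a + Real.smoothTransition (1 - a) = 1 := by
  unfold Real.smoothTransition
  have h := (Real.smoothTransition.pos_denom a).ne'
  rw [sub_sub_cancel, add_comm (expNegInvGlue (1 - a)), ← add_div, div_self h]

/-- A smooth convex approximation of the positive part `t ↦ max t 0` on the real line. -/
theorem exists_smooth_posPart (ε : ℝ) (hε : 0 < ε) :
    ∃ g : ℝ → ℝ, ContDiff ℝ (⊤ : ℕ∞) g ∧ ConvexOn ℝ Set.univ g ∧ Monotone g ∧
      StrictMonoOn g (Set.Ici (-ε)) ∧ (∀ t ≤ -ε, g t = 0) ∧ (∀ t, g t = t + g (-t)) ∧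
      g 0 ≤ ε / 2 := by
  set s : ℝ → ℝ := fun u => Real.smoothTransition ((u + ε) / (2 * ε)) with hs
  have hsc : ContDiff ℝ (⊤ : ℕ∞) s := by
    apply Real.smoothTransition.contDiff.comp
    fun_prop
  have hcont : Continuous s := hsc.continuous
  have hmono : Monotone s := fun a b hab => Real.smoothTransition.monotone (by gcongr)
  have hsymm : ∀ u, s u + s (-u) = 1 := by
    intro u
    have : (-u + ε) / (2 * ε) = 1 - (u + ε) / (2 * ε) := by field_simp; ring
    simp only [hs, this]
    exact smoothTransition_add_one_sub _
  have hzero : ∀ u ≤ -ε, s u = 0 := fun u hu =>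
    Real.smoothTransition.zero_of_nonpos (div_nonpos_of_nonpos_of_nonneg (by linarith) (by linarith))
  have hpos : ∀ u, -ε < u → 0 < s u := fun u hu =>
    Real.smoothTransition.pos_of_pos (div_pos (by linarith) (by linarith))
  have hnonneg : ∀ u, 0 ≤ s u := fun u => Real.smoothTransition.nonneg _
  set g : ℝ → ℝ := fun t => ∫ u in (-ε)..t, s u with hg
  have hderiv : ∀ t, HasDerivAt g (s t) t := fun t =>
    (hcont.integral_hasStrictDerivAt (-ε) t).hasDerivAt
  have hdg : deriv g = s := funext fun t => (hderiv t).deriv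
  have hdiff : Differentiable ℝ g := fun t => (hderiv t).differentiableAt
  have hgm : Monotone g := monotone_of_deriv_nonneg hdiff fun t => by rw [hdg]; exact hnonneg t
  refine ⟨g, contDiff_infty_iff_deriv.2 ⟨hdiff, by rwa [hdg]⟩,
    Monotone.convexOn_univ_of_deriv hdiff (by rwa [hdg]), hgm, ?_, ?_, ?_, ?_⟩
  · refine strictMonoOn_of_deriv_pos (convex_Ici _) hdiff.continuous.continuousOn fun t ht => ?_
    rw [interior_Ici] at ht
    rw [hdg]
    exact hpos t ht
  · intro t ht
    have : Set.EqOn s (fun _ => 0) (Set.uIcc (-ε) t) := fun u hu => by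
      rw [Set.uIcc_of_ge ht] at hu
      exact hzero u hu.2
    simp only [hg]
    rw [intervalIntegral.integral_congr this, intervalIntegral.integral_zero]
  · intro t
    have hd : ∀ t, HasDerivAt (fun t => g t - (t + g (-t))) 0 t := by
      intro t
      have h1 := (hderiv (-t)).comp t (hasDerivAt_neg t)
      have h2 := (hderiv t).sub ((hasDerivAt_id t).add h1)
      exact h2.congr_deriv (by linarith [hsymm t])
    have := is_const_of_deriv_eq_zero (fun t => (hd t).differentiableAt) (fun t => (hd t).deriv) t 0
    simp only [neg_zero, zero_add, sub_self] at this
    linarith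
  · have h : g 0 ≤ ∫ _ in (-ε)..0, (1 / 2 : ℝ) := by
      refine intervalIntegral.integral_mono_on (by linarith) (hcont.intervalIntegrable _ _)
        (continuous_const.intervalIntegrable _ _) fun u hu => ?_
      have h0 := hsymm 0
      rw [neg_zero] at h0
      linarith [hmono hu.2]
    rw [intervalIntegral.integral_const, smul_eq_mul] at h
    linarith

/-- smooth maxima. For every `ε > 0` there is a `C^∞` convex function
`M : ℝ² → ℝ` approximating the maximum, symmetric, 1-Lipschitz for the sup norm
(which is the norm of `ℝ × ℝ` in Mathlib), equal to the max when `|x - y| ≥ ε`,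
and with the stated monotonicity properties. -/
theorem exists_smooth_max (ε : ℝ) (hε : 0 < ε) :
    ∃ M : ℝ × ℝ → ℝ, ContDiff ℝ (⊤ : ℕ∞) M ∧
      ConvexOn ℝ Set.univ M ∧
      (∀ x y : ℝ, max x y ≤ M (x, y) ∧ M (x, y) ≤ max x y + ε / 2) ∧
      (∀ x y : ℝ, ε ≤ |x - y| → M (x, y) = max x y) ∧
      (∀ x y : ℝ, M (x, y) = M (y, x)) ∧
      (∀ p q : ℝ × ℝ, |M p - M q| ≤ max |p.1 - q.1| |p.2 - q.2|) ∧
      (∀ x x' y : ℝ, y - ε ≤ x → x < x' → M (x, y) < M (x', y)) ∧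
      (∀ x y y' : ℝ, x - ε ≤ y → y < y' → M (x, y) < M (x, y')) ∧
      (∀ x x' y y' : ℝ, x ≤ x' → y ≤ y' → M (x, y) ≤ M (x', y')) ∧
      (∀ x x' y y' : ℝ, x < x' → y < y' → M (x, y) < M (x', y')) := by
  obtain ⟨g, hsmooth, hconv, hmono, hstrict, hzero, hrefl, hg0⟩ := exists_smooth_posPart ε hε
  have hnonneg : ∀ t, 0 ≤ g t := fun t =>
    (hzero (min t (-ε)) (min_le_right _ _)).ge.trans (hmono (min_le_left _ _))
  set M : ℝ × ℝ → ℝ := fun p => p.2 + g (p.1 - p.2) with hM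
  have hsymm : ∀ x y : ℝ, M (x, y) = M (y, x) := by
    intro x y
    have h := hrefl (x - y)
    rw [neg_sub] at h
    simp only [hM]
    linarith
  have hfst : ∀ x x' y : ℝ, x ≤ x' → M (x, y) ≤ M (x', y) := fun x x' y h =>
    add_le_add_right (hmono (sub_le_sub_right h y)) y
  have hmonoM : ∀ x x' y y' : ℝ, x ≤ x' → y ≤ y' → M (x, y) ≤ M (x', y') := by
    intro x x' y y' hx hy
    refine (hfst x x' y hx).trans ?_
    rw [hsymm x' y, hsymm x' y']
    exact hfst y y' x' hy
  have hshift : ∀ x y d : ℝ, M (x + d, y + d) = M (x, y) + d := by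
    intro x y d
    simp only [hM, add_sub_add_right_eq_sub]
    ring
  have hfst_lt : ∀ x x' y : ℝ, y - ε ≤ x → x < x' → M (x, y) < M (x', y) := by
    intro x x' y hx h
    have := hstrict (a := x - y) (b := x' - y) (Set.mem_Ici.2 (by linarith))
      (Set.mem_Ici.2 (by linarith)) (by linarith)
    simpa only [hM, add_lt_add_iff_left] using this
  have hlip : ∀ p q : ℝ × ℝ, M p - M q ≤ max |p.1 - q.1| |p.2 - q.2| := by
    intro p q
    set d := max |p.1 - q.1| |p.2 - q.2|
    have h1 : p.1 - q.1 ≤ d := (le_abs_self _).trans (le_max_left _ _)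
    have h2 : p.2 - q.2 ≤ d := (le_abs_self _).trans (le_max_right _ _)
    have h := hmonoM p.1 (q.1 + d) p.2 (q.2 + d) (by linarith) (by linarith)
    rw [hshift] at h
    linarith
  refine ⟨M, ?_, ?_, ?_, ?_, hsymm, ?_, hfst_lt, ?_, hmonoM, ?_⟩
  · exact contDiff_snd.add (hsmooth.comp (contDiff_fst.sub contDiff_snd))
  · have h := hconv.comp_linearMap (LinearMap.fst ℝ ℝ ℝ - LinearMap.snd ℝ ℝ ℝ)
    exact ((LinearMap.snd ℝ ℝ ℝ).convexOn convex_univ).add h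
  · intro x y
    wlog hxy : x ≤ y generalizing x y
    · rw [hsymm x y, max_comm]
      exact this y x (le_of_not_ge hxy)
    have h1 := hnonneg (x - y)
    have h2 : g (x - y) ≤ g 0 := hmono (by linarith)
    rw [max_eq_right hxy]
    simp only [hM]
    constructor <;> linarith
  · intro x y h
    wlog hxy : x ≤ y generalizing x y
    · rw [hsymm x y, max_comm]
      exact this y x (by rwa [abs_sub_comm]) (le_of_not_ge hxy)
    rw [abs_of_nonpos (by linarith)] at h
    simp only [hM]
    rw [max_eq_right hxy, hzero _ (by linarith), add_zero]
  · intro p q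
    refine abs_le.2 ⟨?_, hlip p q⟩
    have h := hlip q p
    rw [abs_sub_comm q.1, abs_sub_comm q.2] at h
    linarith
  · intro x y y' h hy
    rw [hsymm x y, hsymm x y']
    exact hfst_lt y y' x h hy
  · intro x x' y y' hx hy
    have hd : 0 < min (x' - x) (y' - y) := lt_min (by linarith) (by linarith)
    have h := hmonoM (x + min (x' - x) (y' - y)) x' (y + min (x' - x) (y' - y)) y'
      (by linarith [min_le_left (x' - x) (y' - y)]) (by linarith [min_le_right (x' - x) (y' - y)])
    rw [hshift] at h
    linarith
end

section
/- Let ε > 0, let θ : ℝ → ℝ be a C^∞, convex, even, 1-Lipschitz function with θ(t) = |t| if and only if |t| ≥ ε, and define M_ε(x, y) = (x + y + θ(x − y))/2. Let U be an open convex subset of a real Banach space X and let f, g : U → ℝ be convex functions. Then the function x ↦ M_ε(f(x), g(x)) is convex on U. -/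
/-- the smooth maximum `M_ε(x, y) = (x + y + θ (x - y)) / 2` of two
convex functions `f, g` on an open convex set `U` is convex on `U`. -/
theorem smooth_max_convex (ε : ℝ) (hε : 0 < ε) (θ : ℝ → ℝ)
    (hθ_smooth : ContDiff ℝ (⊤ : ℕ∞) θ) (hθ_conv : ConvexOn ℝ Set.univ θ)
    (hθ_even : ∀ t : ℝ, θ (-t) = θ t) (hθ_lip : LipschitzWith 1 θ)
    (hθ_abs : ∀ t : ℝ, θ t = |t| ↔ ε ≤ |t|)
    {X : Type*} [NormedAddCommGroup X] [NormedSpace ℝ X] [CompleteSpace X]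
    (U : Set X) (hUopen : IsOpen U) (hUconv : Convex ℝ U)
    (f g : X → ℝ) (hf : ConvexOn ℝ U f) (hg : ConvexOn ℝ U g) :
    ConvexOn ℝ U (fun x => (f x + g x + θ (f x - g x)) / 2) := by
  refine ⟨hUconv, fun x hx y hy a b ha hb hab => ?_⟩
  have hfz := hf.2 hx hy ha hb hab
  have hgz := hg.2 hx hy ha hb hab
  have hθz := hθ_conv.2 (Set.mem_univ (f x - g x)) (Set.mem_univ (f y - g y)) ha hb hab
  simp only [smul_eq_mul] at hfz hgz hθz ⊢
  have hlip := hθ_lip.dist_le_mul (f (a • x + b • y) - g (a • x + b • y))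
    (a * (f x - g x) + b * (f y - g y))
  rw [Real.dist_eq, Real.dist_eq, NNReal.coe_one, one_mul] at hlip
  have habs : |f (a • x + b • y) - g (a • x + b • y) - (a * (f x - g x) + b * (f y - g y))| ≤
      (a * f x + b * f y - f (a • x + b • y)) + (a * g x + b * g y - g (a • x + b • y)) :=
    abs_le.2 ⟨by linarith, by linarith⟩
  linarith [(le_abs_self _).trans (hlip.trans habs)]
end

section
/- Let ε > 0, let θ : ℝ → ℝ be a C^∞, convex, even, 1-Lipschitz function with θ(t) = |t| if and only if |t| ≥ ε, and define M_ε(x, y) = (x + y + θ(x − y))/2. Let U be an open convex subset of a real Banach space X, let f, g : U → ℝ be convex functions, and let B ⊆ U be a convex set on which both f and g are strictly convex. Then the function x ↦ M_ε(f(x), g(x)) is strictly convex on B. -/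
/-- If `θ` is convex and `1`-Lipschitz, then `(f + g + θ ∘ (f - g)) / 2` is strictly convex
wherever `f` and `g` are. -/
theorem StrictConvexOn.half_add_add_comp_sub {E : Type*} [AddCommMonoid E] [Module ℝ E]
    {s : Set E} {f g : E → ℝ} {θ : ℝ → ℝ} (hf : StrictConvexOn ℝ s f)
    (hg : StrictConvexOn ℝ s g) (hθ_conv : ConvexOn ℝ Set.univ θ) (hθ_lip : LipschitzWith 1 θ) :
    StrictConvexOn ℝ s (fun x => (f x + g x + θ (f x - g x)) / 2) := by
  refine ⟨hf.1, fun x hx y hy hxy a b ha hb hab => ?_⟩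
  have hfz := hf.2 hx hy hxy ha hb hab
  have hgz := hg.2 hx hy hxy ha hb hab
  have hconv := hθ_conv.2 (Set.mem_univ (f x - g x)) (Set.mem_univ (f y - g y)) ha.le hb.le hab
  simp only [smul_eq_mul] at hfz hgz hconv ⊢
  have hlip := hθ_lip.dist_le_mul (f (a • x + b • y) - g (a • x + b • y))
    (a * (f x - g x) + b * (f y - g y))
  rw [NNReal.coe_one, one_mul, Real.dist_eq, Real.dist_eq] at hlip
  have hθ := (le_abs_self _).trans hlip
  rcases abs_cases (f (a • x + b • y) - g (a • x + b • y) -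
    (a * (f x - g x) + b * (f y - g y))) with ⟨h, -⟩ | ⟨h, -⟩ <;>
  · rw [h] at hθ
    linarith

/-- the smooth maximum `M_ε(x, y) = (x + y + θ (x - y)) / 2` of two
convex functions `f, g` that are strictly convex on a convex set `B ⊆ U` is
strictly convex on `B`. -/
theorem smooth_max_strictConvexOn (ε : ℝ) (hε : 0 < ε) (θ : ℝ → ℝ)
    (hθ_smooth : ContDiff ℝ (⊤ : ℕ∞) θ) (hθ_conv : ConvexOn ℝ Set.univ θ)
    (hθ_even : ∀ t : ℝ, θ (-t) = θ t) (hθ_lip : LipschitzWith 1 θ)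
    (hθ_abs : ∀ t : ℝ, θ t = |t| ↔ ε ≤ |t|)
    {X : Type*} [NormedAddCommGroup X] [NormedSpace ℝ X] [CompleteSpace X]
    (U : Set X) (hUopen : IsOpen U) (hUconv : Convex ℝ U)
    (f g : X → ℝ) (hf : ConvexOn ℝ U f) (hg : ConvexOn ℝ U g)
    (B : Set X) (hBU : B ⊆ U) (hBconv : Convex ℝ B)
    (hf_strict : StrictConvexOn ℝ B f) (hg_strict : StrictConvexOn ℝ B g) :
    StrictConvexOn ℝ B (fun x => (f x + g x + θ (f x - g x)) / 2) :=
  hf_strict.half_add_add_comp_sub hg_strict hθ_conv hθ_lip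
end

section
/- Let U be an open convex subset of a real normed space X, let f : U → ℝ be a convex function, let n > 0, and let x ∈ U be a point such that f is n-Lipschitz on some open neighborhood of x contained in U. Then f(x) ≤ f(y) + n‖x − y‖ for every y ∈ U. -/
/-- if `f` is convex on an open convex set `U` and `n`-Lipschitz on an
open neighborhood of `x ∈ U` contained in `U`, then `f x ≤ f y + n * ‖x - y‖` for
every `y ∈ U`. -/
theorem convex_global_lower_bound_of_local_lipschitz
    {X : Type*} [NormedAddCommGroup X] [NormedSpace ℝ X]
    (U : Set X) (hUopen : IsOpen U) (hUconv : Convex ℝ U)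
    (f : X → ℝ) (hfconv : ConvexOn ℝ U f)
    (n : ℝ) (hn : 0 < n) (x : X) (hx : x ∈ U)
    (hloc : ∃ V : Set X, IsOpen V ∧ x ∈ V ∧ V ⊆ U ∧
      ∀ u ∈ V, ∀ v ∈ V, |f u - f v| ≤ n * ‖u - v‖) :
    ∀ y ∈ U, f x ≤ f y + n * ‖x - y‖ := by
  obtain ⟨V, hVopen, hxV, -, hlip⟩ := hloc
  intro y hy
  have hcont : Continuous fun t : ℝ => (1 - t) • x + t • y := by fun_prop
  have hnear : ∀ᶠ t in nhdsWithin (0 : ℝ) (Set.Ioi 0), (1 - t) • x + t • y ∈ V :=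
    (hcont.continuousAt.eventually_mem (hVopen.mem_nhds (by simpa using hxV))).filter_mono
      nhdsWithin_le_nhds
  obtain ⟨t, htV, ht0, ht1⟩ := (hnear.and (Ioo_mem_nhdsGT (zero_lt_one' ℝ))).exists
  have hconv := hfconv.2 hx hy (sub_nonneg.2 ht1.le) ht0.le (sub_add_cancel 1 t)
  have hbound := (le_abs_self _).trans (hlip x hxV _ htV)
  have hsub : x - ((1 - t) • x + t • y) = t • (x - y) := by module
  rw [hsub, norm_smul, Real.norm_of_nonneg ht0.le] at hbound
  simp only [smul_eq_mul] at hconv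
  refine le_of_mul_le_mul_left ?_ ht0
  linarith
end

section
/- On the real Hilbert space ℓ₂ of square-summable real sequences, the function f(x) = Σ_{n=1}^∞ |xₙ|^{2n} is well defined (the series converges for every x ∈ ℓ₂), convex, and continuous on ℓ₂, but f is not bounded above on the open ball of center 0 and radius 2 in ℓ₂. -/
open Filter Topology in
theorem summable_pow_two_mul_succ_of_tendsto {a : ℕ → ℝ} {c : ℝ} (ha : ∀ n, 0 ≤ a n)
    (hc : c < 1) (h : Tendsto a atTop (𝓝 c)) :
    Summable (fun n : ℕ => a n ^ (2 * (n + 1))) := by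
  obtain ⟨r, hcr, hr1⟩ := exists_between hc
  have hr0 : 0 ≤ r := (ge_of_tendsto' h ha).trans hcr.le
  have hgeom : Summable (fun n : ℕ => r ^ (2 * (n + 1))) := by
    simp_rw [pow_mul]
    exact (summable_nat_add_iff 1).2
      (summable_geometric_of_lt_one (by positivity) (pow_lt_one₀ hr0 hr1 two_ne_zero))
  refine hgeom.of_norm_bounded_eventually_nat ?_
  filter_upwards [h.eventually_le_const hcr] with n hn
  rw [Real.norm_of_nonneg (pow_nonneg (ha n) _)]
  exact pow_le_pow_left₀ (ha n) hn _

open Filter Topology in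
theorem lp_two_tendsto_abs_zero (x : lp (fun _ : ℕ => ℝ) 2) :
    Tendsto (fun n => |x n|) atTop (𝓝 0) := by
  have h := (lp.memℓp x).summable (by norm_num)
  have h2 : Tendsto (fun n => x n ^ 2) atTop (𝓝 0) := by
    simpa using h.tendsto_atTop_zero
  simpa [Real.sqrt_sq_eq_abs] using h2.sqrt

theorem lp_two_summable_abs_pow (x : lp (fun _ : ℕ => ℝ) 2) :
    Summable (fun n : ℕ => |x n| ^ (2 * (n + 1))) :=
  summable_pow_two_mul_succ_of_tendsto (fun _ => abs_nonneg _) one_pos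
    (lp_two_tendsto_abs_zero x)

theorem lp_two_convexOn_tsum_abs_pow :
    ConvexOn ℝ Set.univ
      (fun x : lp (fun _ : ℕ => ℝ) 2 => ∑' n : ℕ, |x n| ^ (2 * (n + 1))) := by
  refine ⟨convex_univ, fun x _ y _ a b ha hb hab => ?_⟩
  have hx := (lp_two_summable_abs_pow x).mul_left a
  have hy := (lp_two_summable_abs_pow y).mul_left b
  simp only [smul_eq_mul]
  rw [← tsum_mul_left, ← tsum_mul_left, ← hx.tsum_add hy]
  refine (lp_two_summable_abs_pow _).tsum_le_tsum (fun n => ?_) (hx.add hy)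
  have heven : Even (2 * (n + 1)) := even_two_mul _
  simp only [heven.pow_abs]
  exact heven.convexOn_pow.2 (Set.mem_univ (x n)) (Set.mem_univ (y n)) ha hb hab

theorem lp_two_continuous_tsum_abs_pow :
    Continuous
      (fun x : lp (fun _ : ℕ => ℝ) 2 => ∑' n : ℕ, |x n| ^ (2 * (n + 1))) := by
  refine continuous_iff_continuousAt.2 fun x => ?_
  have hsum : Summable (fun n : ℕ => (|x n| + 1 / 2) ^ (2 * (n + 1))) :=
    summable_pow_two_mul_succ_of_tendsto (fun _ => by positivity) (by norm_num)
      ((lp_two_tendsto_abs_zero x).add_const (1 / 2))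
  refine (continuousOn_tsum (s := Metric.ball x (1 / 2)) (fun n => ?_) hsum
    fun n y hy => ?_).continuousAt (Metric.ball_mem_nhds x (by norm_num))
  · have hcoord : Continuous fun y : lp (fun _ : ℕ => ℝ) 2 => y n :=
      (lp.evalCLM ℝ (fun _ : ℕ => ℝ) 2 n).continuous
    exact (hcoord.abs.pow _).continuousOn
  · rw [Real.norm_of_nonneg (by positivity)]
    have hdist : |y n - x n| < 1 / 2 :=
      (lp.norm_apply_le_norm two_ne_zero (y - x) n).trans_lt (mem_ball_iff_norm.1 hy)
    have habs := abs_sub_abs_le_abs_sub (y n) (x n)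
    exact pow_le_pow_left₀ (abs_nonneg _) (by linarith) _

theorem lp_two_not_bddAbove_tsum_abs_pow :
    ¬ BddAbove ((fun x : lp (fun _ : ℕ => ℝ) 2 =>
        ∑' n : ℕ, |x n| ^ (2 * (n + 1))) '' Metric.ball 0 2) := by
  rintro ⟨M, hM⟩
  obtain ⟨n, hn⟩ := pow_unbounded_of_one_lt M (by norm_num : (1 : ℝ) < 3 / 2)
  let x : lp (fun _ : ℕ => ℝ) 2 := lp.single 2 n (3 / 2 : ℝ)
  have hx : x ∈ Metric.ball 0 2 := by
    rw [mem_ball_zero_iff, lp.norm_single (by norm_num)]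
    norm_num
  have hterm : |x n| ^ (2 * (n + 1)) ≤ M :=
    ((lp_two_summable_abs_pow x).le_tsum n fun _ _ => by positivity).trans
      (hM (Set.mem_image_of_mem _ hx))
  have hxn : |x n| = 3 / 2 := by
    simp [x, abs_of_pos]
  rw [hxn] at hterm
  have hpow : (3 / 2 : ℝ) ^ n ≤ (3 / 2) ^ (2 * (n + 1)) :=
    pow_le_pow_right₀ (by norm_num) (by omega)
  linarith

/-- on `ℓ₂`, the function `f x = Σₙ |xₙ| ^ (2n)` (indexed here from
`n = 0`, i.e. `f x = Σ_{n≥0} |x n| ^ (2(n+1))`) is well defined (the series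
converges for every `x ∈ ℓ₂`), convex and continuous, but not bounded above on the
open ball of center `0` and radius `2`. -/
theorem ell2_convex_unbounded_on_ball :
    (∀ x : lp (fun _ : ℕ => ℝ) 2,
      Summable (fun n : ℕ => |x n| ^ (2 * (n + 1)))) ∧
    ConvexOn ℝ Set.univ
      (fun x : lp (fun _ : ℕ => ℝ) 2 => ∑' n : ℕ, |x n| ^ (2 * (n + 1))) ∧
    Continuous
      (fun x : lp (fun _ : ℕ => ℝ) 2 => ∑' n : ℕ, |x n| ^ (2 * (n + 1))) ∧
    ¬ BddAbove ((fun x : lp (fun _ : ℕ => ℝ) 2 =>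
        ∑' n : ℕ, |x n| ^ (2 * (n + 1))) '' Metric.ball 0 2) := by
  exact ⟨lp_two_summable_abs_pow, lp_two_convexOn_tsum_abs_pow,
    lp_two_continuous_tsum_abs_pow, lp_two_not_bddAbove_tsum_abs_pow⟩
end

section
/- Let φ : [0, ∞) → [0, ∞) be a convex function with t ≤ φ(t) ≤ 2t for all t ≥ 0. Then the function g(x) = Σ_{n=1}^∞ φ(|xₙ|)^{2n} is well defined (the series converges for every x ∈ ℓ₂), convex, and continuous on the real Hilbert space ℓ₂, but g is not bounded above on the open ball of center 0 and radius 2 in ℓ₂. -/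
open Filter Topology

section

variable {φ : ℝ → ℝ}

lemma monotoneOn_Ici_of_convexOn_of_le_of_le_two_mul
    (hφconv : ConvexOn ℝ (Set.Ici (0 : ℝ)) φ)
    (hφ : ∀ t : ℝ, 0 ≤ t → t ≤ φ t ∧ φ t ≤ 2 * t) :
    MonotoneOn φ (Set.Ici (0 : ℝ)) := by
  intro s hs t ht hst
  rw [Set.mem_Ici] at hs ht
  rcases ht.eq_or_lt with rfl | htpos
  · rw [le_antisymm hst hs]
  · have h0 : φ 0 ≤ 0 := by simpa using (hφ 0 le_rfl).2
    have hle : s / t ≤ 1 := (div_le_one htpos).2 hst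
    have h := hφconv.2 (Set.mem_Ici.2 ht) (Set.mem_Ici.2 le_rfl) (div_nonneg hs ht)
      (sub_nonneg.2 hle) (by ring)
    simp only [smul_eq_mul, mul_zero, add_zero, div_mul_cancel₀ s htpos.ne'] at h
    have hφt : 0 ≤ φ t := ht.trans (hφ t ht).1
    nlinarith [mul_nonneg (sub_nonneg.2 hle) hφt,
      mul_nonneg (sub_nonneg.2 hle) (neg_nonneg.2 h0)]

lemma convexOn_comp_abs_pow
    (hφconv : ConvexOn ℝ (Set.Ici (0 : ℝ)) φ)
    (hφ : ∀ t : ℝ, 0 ≤ t → t ≤ φ t ∧ φ t ≤ 2 * t) (k : ℕ) :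
    ConvexOn ℝ Set.univ (fun t : ℝ => φ |t| ^ k) := by
  have habs : ConvexOn ℝ Set.univ (fun t : ℝ => φ |t|) := by
    refine ⟨convex_univ, fun x _ y _ a b ha hb hab => ?_⟩
    have h := hφconv.2 (Set.mem_Ici.2 (abs_nonneg x)) (Set.mem_Ici.2 (abs_nonneg y)) ha hb hab
    refine le_trans ?_ h
    apply monotoneOn_Ici_of_convexOn_of_le_of_le_two_mul hφconv hφ
    · exact Set.mem_Ici.2 (abs_nonneg _)
    · simp only [Set.mem_Ici, smul_eq_mul]
      positivity
    · simpa [abs_mul, abs_of_nonneg ha, abs_of_nonneg hb] using abs_add_le (a * x) (b * y)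
  exact habs.pow (fun {t} _ => (abs_nonneg t).trans (hφ _ (abs_nonneg t)).1) k

/-- If `aₙ → 0`, the powers of `2 (|aₙ| + 1/8)` are eventually dominated by those of `1/2`. -/
lemma summable_two_mul_abs_add_pow {a : ℕ → ℝ} (ha : Tendsto a atTop (𝓝 0)) :
    Summable (fun n : ℕ => (2 * (|a n| + 1 / 8)) ^ (2 * (n + 1))) := by
  refine summable_of_isBigO_nat (summable_geometric_of_lt_one (r := (1 / 2 : ℝ))
    (by norm_num) (by norm_num)) (Asymptotics.IsBigO.of_bound 1 ?_)
  have hsmall : ∀ᶠ n in atTop, |a n| < 1 / 8 := by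
    simpa using ha.abs.eventually_lt_const (by norm_num : |(0 : ℝ)| < 1 / 8)
  filter_upwards [hsmall] with n hn
  rw [Real.norm_of_nonneg (by positivity), Real.norm_of_nonneg (by positivity), one_mul]
  calc (2 * (|a n| + 1 / 8)) ^ (2 * (n + 1)) ≤ (1 / 2 : ℝ) ^ (2 * (n + 1)) := by
        gcongr
        linarith
    _ ≤ (1 / 2) ^ n := pow_le_pow_of_le_one (by norm_num) (by norm_num) (by omega)

lemma comp_abs_pow_le (hφ : ∀ t : ℝ, 0 ≤ t → t ≤ φ t ∧ φ t ≤ 2 * t)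
    {s t : ℝ} (hst : |s| ≤ t) (k : ℕ) : ‖φ |s| ^ k‖ ≤ (2 * t) ^ k := by
  have h := hφ |s| (abs_nonneg s)
  have h0 : 0 ≤ φ |s| := (abs_nonneg s).trans h.1
  rw [Real.norm_of_nonneg (by positivity)]
  gcongr
  linarith

end

lemma lp_two_tendsto_zero (x : lp (fun _ : ℕ => ℝ) 2) :
    Tendsto (fun n => x n) atTop (𝓝 0) := by
  have h : Summable (fun n => ‖x n‖ ^ 2) := by
    simpa using (lp.memℓp x).summable (by norm_num)
  have h2 := h.tendsto_atTop_zero.sqrt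
  simp only [Real.sqrt_sq (norm_nonneg _), Real.sqrt_zero] at h2
  exact tendsto_zero_iff_norm_tendsto_zero.2 h2


/-- if `φ : [0, ∞) → [0, ∞)` is convex with `t ≤ φ t ≤ 2t`, then on
`ℓ₂` the function `g x = Σₙ φ(|xₙ|) ^ (2n)` (indexed here from `n = 0`, i.e.
`g x = Σ_{n≥0} φ(|x n|) ^ (2(n+1))`) is well defined (the series converges for
every `x ∈ ℓ₂`), convex and continuous, but not bounded above on the open ball of
center `0` and radius `2`. -/
theorem ell2_phi_convex_unbounded_on_ball
    (φ : ℝ → ℝ) (hφconv : ConvexOn ℝ (Set.Ici (0 : ℝ)) φ)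
    (hφ : ∀ t : ℝ, 0 ≤ t → t ≤ φ t ∧ φ t ≤ 2 * t) :
    (∀ x : lp (fun _ : ℕ => ℝ) 2,
      Summable (fun n : ℕ => φ |x n| ^ (2 * (n + 1)))) ∧
    ConvexOn ℝ Set.univ
      (fun x : lp (fun _ : ℕ => ℝ) 2 => ∑' n : ℕ, φ |x n| ^ (2 * (n + 1))) ∧
    Continuous
      (fun x : lp (fun _ : ℕ => ℝ) 2 => ∑' n : ℕ, φ |x n| ^ (2 * (n + 1))) ∧
    ¬ BddAbove ((fun x : lp (fun _ : ℕ => ℝ) 2 =>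
        ∑' n : ℕ, φ |x n| ^ (2 * (n + 1))) '' Metric.ball 0 2) := by
  have hsum : ∀ x : lp (fun _ : ℕ => ℝ) 2,
      Summable (fun n : ℕ => φ |x n| ^ (2 * (n + 1))) := fun x =>
    (summable_two_mul_abs_add_pow (lp_two_tendsto_zero x)).of_norm_bounded
      fun n => comp_abs_pow_le hφ (by linarith) _
  refine ⟨hsum, ⟨convex_univ, fun x _ y _ a b ha hb hab => ?_⟩, ?_, ?_⟩
  · simp only [smul_eq_mul]
    rw [← tsum_mul_left, ← tsum_mul_left,
      ← ((hsum x).mul_left a).tsum_add ((hsum y).mul_left b)]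
    refine (hsum _).tsum_le_tsum (fun n => ?_) (((hsum x).mul_left a).add ((hsum y).mul_left b))
    exact (convexOn_comp_abs_pow hφconv hφ (2 * (n + 1))).2
      (Set.mem_univ (x n)) (Set.mem_univ (y n)) ha hb hab
  · refine continuous_iff_continuousAt.2 fun x => ?_
    refine ContinuousOn.continuousAt (s := Metric.ball x (1 / 8)) ?_
      (Metric.ball_mem_nhds x (by norm_num))
    refine continuousOn_tsum (fun n => ?_)
      (summable_two_mul_abs_add_pow (lp_two_tendsto_zero x)) fun n y hy => ?_
    · have hcont : Continuous (fun t : ℝ => φ |t| ^ (2 * (n + 1))) :=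
        continuousOn_univ.1
          ((convexOn_comp_abs_pow hφconv hφ (2 * (n + 1))).continuousOn isOpen_univ)
      exact (hcont.comp (lp.evalCLM ℝ (fun _ : ℕ => ℝ) 2 n).continuous).continuousOn
    · refine comp_abs_pow_le hφ ?_ _
      have hn : |y n - x n| ≤ ‖y - x‖ := lp.norm_apply_le_norm two_ne_zero (y - x) n
      rw [mem_ball_iff_norm] at hy
      have htri := abs_add_le (x n) (y n - x n)
      rw [add_sub_cancel] at htri
      linarith
  · rintro ⟨M, hM⟩
    obtain ⟨n, hn⟩ := pow_unbounded_of_one_lt M (by norm_num : (1 : ℝ) < 3 / 2)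
    set x : lp (fun _ : ℕ => ℝ) 2 := lp.single 2 n (3 / 2 : ℝ) with hx
    have hmem : x ∈ Metric.ball (0 : lp (fun _ : ℕ => ℝ) 2) 2 := by
      rw [mem_ball_zero_iff, hx, lp.norm_single (by norm_num)]
      norm_num
    have hle := hM (Set.mem_image_of_mem _ hmem)
    have hterm : φ |x n| ^ (2 * (n + 1)) ≤ ∑' k : ℕ, φ |x k| ^ (2 * (k + 1)) :=
      (hsum x).le_tsum n fun k _ =>
        pow_nonneg ((abs_nonneg _).trans (hφ _ (abs_nonneg _)).1) _
    have hxn : |x n| = 3 / 2 := by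
      rw [hx, lp.single_apply_self]
      norm_num
    rw [hxn] at hterm
    have hpow : (3 / 2 : ℝ) ^ n ≤ φ (3 / 2) ^ (2 * (n + 1)) :=
      calc (3 / 2 : ℝ) ^ n ≤ (3 / 2) ^ (2 * (n + 1)) :=
            pow_le_pow_right₀ (by norm_num) (by omega)
        _ ≤ φ (3 / 2) ^ (2 * (n + 1)) := by
            gcongr
            exact (hφ _ (by norm_num)).1
    exact absurd (hn.trans_le (hpow.trans (hterm.trans hle))) (lt_irrefl M)
end

section
/- Let X be a real Banach space and suppose there exists a convex function φ : X → ℝ of class C¹ on X such that ‖x‖ − 1/4 ≤ φ(x) ≤ ‖x‖ for all x ∈ X. Then X admits a C¹ bump function: there exists ψ : X → ℝ of class C¹ with ψ(0) = 1 and ψ(x) = 0 whenever ‖x‖ ≥ 1. -/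
/-- if a Banach space `X` carries a `C¹` convex function `φ` with
`‖x‖ - 1/4 ≤ φ x ≤ ‖x‖`, then `X` admits a `C¹` bump function `ψ` with `ψ 0 = 1`
and `ψ x = 0` for `‖x‖ ≥ 1`. -/
theorem exists_C1_bump_of_C1_convex_norm_approx
    {X : Type*} [NormedAddCommGroup X] [NormedSpace ℝ X] [CompleteSpace X]
    (φ : X → ℝ) (hφconv : ConvexOn ℝ Set.univ φ) (hφsmooth : ContDiff ℝ 1 φ)
    (hφ : ∀ x : X, ‖x‖ - 1 / 4 ≤ φ x ∧ φ x ≤ ‖x‖) :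
    ∃ ψ : X → ℝ, ContDiff ℝ 1 ψ ∧ ψ 0 = 1 ∧ ∀ x : X, 1 ≤ ‖x‖ → ψ x = 0 := by
  refine ⟨fun x => 1 - Real.smoothTransition (2 * φ x), ?_, ?_, ?_⟩
  · exact contDiff_const.sub
      (Real.smoothTransition.contDiff.comp (contDiff_const.mul hφsmooth))
  · have h := (hφ 0).2
    rw [norm_zero] at h
    simp [Real.smoothTransition.zero_of_nonpos (show 2 * φ 0 ≤ 0 by linarith)]
  · intro x hx
    have h := (hφ x).1
    simp [Real.smoothTransition.one_of_one_le (show 1 ≤ 2 * φ x by linarith)]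
end
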